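/- Every finitely generated ideal of a commutative Hopf algebra over ℂ is finitely presented as a module. Equivalently, the algebra of global functions O(Π) on any affine group scheme Π over ℂ is a coherent ring. -/

import Mathlib

open scoped TensorProduct
open Coalgebra

/-- If a multilinear map sends families from `X` into an ideal, so does it for families in the span. -/
lemma multilinear_mem_of_span {C N : Type*} [CommRing C] [AddCommGroup N] [Module C N] {p : ℕ}
    (f : MultilinearMap C (fun _ : Fin p => N) C) (J : Ideal C) (X : Set N)
    (h : ∀ x : Fin p → N, (∀ a, x a ∈ X) → f x ∈ J)
    (x : Fin p → N) (hx : ∀ a, x a ∈ Submodule.span C X) : f x ∈ J := by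
  have hx' := fun a => Submodule.mem_span_set'.1 (hx a)
  choose n c g hg using hx'
  have : x = fun a => ∑ i, c a i • (g a i : N) := by
    funext a; exact (hg a).symm
  rw [this, MultilinearMap.map_sum]
  refine Ideal.sum_mem _ fun r _ => ?_
  rw [MultilinearMap.map_smul_univ f (fun a => c a (r a)) (fun a => (g a (r a) : N))]
  exact Ideal.mul_mem_left _ _ (h _ fun a => (g a (r a)).2)

/-- Minors of `u * x`, with the rows of `x` in the span of `X`, lie in any ideal containing all the
minors of families from `X`. -/
lemma minor_mem_of_span {C : Type*} [CommRing C] {p m : ℕ} (J : Ideal C) (X : Set (Fin m → C))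
    (h : ∀ x : Fin p → (Fin m → C), (∀ a, x a ∈ X) → ∀ e : Fin p → Fin m,
      (Matrix.of fun a b => x a (e b)).det ∈ J)
    (u : Fin p → Fin m → C)
    (x : Fin p → (Fin m → C)) (hx : ∀ a, x a ∈ Submodule.span C X) :
    (Matrix.of fun a b => ∑ k, u b k * x a k).det ∈ J := by
  let U : (Fin m → C) →ₗ[C] (Fin p → C) := Matrix.mulVecLin (Matrix.of u)
  let f : MultilinearMap C (fun _ : Fin p => (Fin m → C)) C :=
    (Matrix.detRowAlternating (R := C) (n := Fin p)).toMultilinearMap.compLinearMap (fun _ => U)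
  have hf : ∀ y, f y = (Matrix.of fun a b => ∑ k, u b k * y a k).det := fun y => rfl
  rw [← hf]
  refine multilinear_mem_of_span f J X ?_ x hx
  intro y hy
  rw [hf, ← Matrix.det_transpose]
  refine multilinear_mem_of_span (Matrix.detRowAlternating (R := C) (n := Fin p)).toMultilinearMap
    J (Set.range fun k : Fin m => fun a => y a k) ?_
    (fun b a => ∑ k, u b k * y a k) ?_
  · intro z hz
    choose e he using hz
    have := h y hy e
    rw [← Matrix.det_transpose] at this
    convert this using 1
    change Matrix.det _ = _
    congr 1
    ext b a
    simp [← he]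
  · intro b
    have : (fun a => ∑ k, u b k * y a k) = ∑ k, u b k • (fun a => y a k) := by
      ext a; simp
    rw [this]
    exact Submodule.sum_mem _ fun k _ => Submodule.smul_mem _ _ (Submodule.subset_span ⟨k, rfl⟩)

/-- The bordered determinant. -/
noncomputable def bordered {C : Type*} [CommRing C] {p m : ℕ} (r : Fin p → Fin m → C)
    (e : Fin p → Fin m) (x : Fin m → C) (j : Fin m) : C :=
  (Matrix.of fun (a b : Fin (p+1)) =>
    (Fin.cons x r : Fin (p+1) → Fin m → C) a ((Fin.cons j e : Fin (p+1) → Fin m) b)).det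

lemma bordered_sum {C : Type*} [CommRing C] {p m n : ℕ} (r : Fin p → Fin m → C)
    (e : Fin p → Fin m) (f : Fin n → C) (x : Fin n → Fin m → C) (j : Fin m) :
    bordered r e (fun k => ∑ i, f i * x i k) j = ∑ i, f i * bordered r e (x i) j := by
  simp only [bordered]
  simp_rw [Matrix.det_succ_row_zero, Finset.mul_sum]
  rw [Finset.sum_comm]
  refine Finset.sum_congr rfl fun b _ => ?_
  simp only [Matrix.of_apply, Fin.cons_zero, Finset.mul_sum, Finset.sum_mul]
  refine Finset.sum_congr rfl fun i _ => ?_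
  have : ∀ y : Fin m → C, (Matrix.submatrix (Matrix.of fun (a b : Fin (p+1)) =>
      (Fin.cons y r : Fin (p+1) → Fin m → C) a ((Fin.cons j e : Fin (p+1) → Fin m) b)) Fin.succ
      b.succAbove) = Matrix.of fun a c => r a ((Fin.cons j e : Fin (p+1) → Fin m) (b.succAbove c)) := by
    intro y; ext a c; simp
  rw [this, this]; ring

lemma bordered_expand {C : Type*} [CommRing C] {p m : ℕ} (r : Fin p → Fin m → C)
    (e : Fin p → Fin m) (x : Fin m → C) : ∃ c : Fin p → C, ∀ j,
    bordered r e x j = (Matrix.of fun a b => r a (e b)).det * x j + ∑ a, c a * r a j := by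
  refine ⟨fun a => (-1) ^ ((a.succ : Fin (p+1)) : ℕ) * (Matrix.of fun (a' b : Fin p) =>
    (Fin.cons x r : Fin (p+1) → Fin m → C) (a.succ.succAbove a') (e b)).det, fun j => ?_⟩
  rw [bordered, Matrix.det_succ_column_zero, Fin.sum_univ_succ]
  congr 1
  · simp only [Matrix.of_apply, Fin.cons_zero, Fin.val_zero, pow_zero, one_mul]
    rw [mul_comm]; congr 2
  · refine Finset.sum_congr rfl fun a _ => ?_
    simp only [Matrix.of_apply, Fin.cons_zero, Fin.cons_succ]
    rw [mul_right_comm]; congr 3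

lemma bordered_mem {C : Type*} [CommRing C] [Algebra ℂ C] (A : Subalgebra ℂ C) {p m : ℕ}
    (r : Fin p → Fin m → C) (e : Fin p → Fin m) (x : Fin m → C) (j : Fin m)
    (hr : ∀ a k, r a k ∈ A) (hx : ∀ k, x k ∈ A) : bordered r e x j ∈ A := by
  rw [bordered, Matrix.det_apply]
  refine sum_mem fun σ _ => ?_
  rw [Units.smul_def]
  refine zsmul_mem (prod_mem fun i _ => ?_) _
  simp only [Matrix.of_apply]
  refine Fin.cases ?_ (fun a => ?_) (σ i)
  · simpa using hx _
  · simpa using hr _ _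

/-- Local finiteness: finite subsets lie in a finite dimensional right coideal. -/
lemma exists_coideal {O : Type*} [CommRing O] [HopfAlgebra ℂ O] (s : Finset O) :
    ∃ (m : ℕ) (v : Fin m → O) (t : Fin m → Fin m → O),
      LinearIndependent ℂ v ∧ (∀ i, comul (R := ℂ) (v i) = ∑ k, v k ⊗ₜ[ℂ] t k i) ∧
      (∀ f ∈ s, f ∈ Submodule.span ℂ (Set.range v)) := by
  classical
  let act : (O →ₗ[ℂ] ℂ) → O →ₗ[ℂ] O := fun φ =>
    (TensorProduct.rid ℂ O).toLinearMap ∘ₗ φ.lTensor O ∘ₗ comul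
  have hact : ∀ φ ψ f, ∃ χ, act ψ (act φ f) = act χ f := by
    intro φ ψ f
    refine ⟨LinearMap.mul' ℂ ℂ ∘ₗ TensorProduct.map ψ φ ∘ₗ comul, ?_⟩
    have key : ∀ z : O ⊗[ℂ] O, 
        TensorProduct.rid ℂ O (ψ.lTensor O (comul (TensorProduct.rid ℂ O (φ.lTensor O z)))) =
        TensorProduct.rid ℂ O ((LinearMap.mul' ℂ ℂ ∘ₗ TensorProduct.map ψ φ).lTensor O
          (TensorProduct.assoc ℂ O O O (comul.rTensor O z))) := by
      intro z
      induction z with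
      | zero => simp
      | add x y hx hy => simp only [map_add, hx, hy]
      | tmul x y =>
        simp only [LinearMap.lTensor_tmul, TensorProduct.rid_tmul, LinearMap.rTensor_tmul, map_smul]
        induction (comul (R := ℂ) x) with
        | zero => simp
        | add x y hx hy => simp only [map_add, TensorProduct.add_tmul, smul_add, hx, hy]
        | tmul a b => simp [smul_smul, mul_comm]
    simp only [act, LinearMap.comp_apply, LinearEquiv.coe_coe]
    rw [key, Coalgebra.coassoc_apply, ← LinearMap.comp_apply (LinearMap.lTensor O _),
      ← LinearMap.lTensor_comp]
    rfl
  let W : Submodule ℂ O := Submodule.span ℂ {w | ∃ f ∈ s, ∃ φ, w = act φ f}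
  have hWact : ∀ w ∈ W, ∀ ψ, act ψ w ∈ W := by
    intro w hw ψ
    induction hw using Submodule.span_induction with
    | mem x hx =>
      obtain ⟨f, hf, φ, rfl⟩ := hx
      obtain ⟨χ, h⟩ := hact φ ψ f
      rw [h]; exact Submodule.subset_span ⟨f, hf, χ, rfl⟩
    | zero => simp
    | add x y _ _ hx hy => rw [map_add]; exact add_mem hx hy
    | smul c x _ hx => rw [map_smul]; exact Submodule.smul_mem _ _ hx
  have hsW : ∀ f ∈ s, f ∈ W := by
    intro f hf
    refine Submodule.subset_span ⟨f, hf, counit, ?_⟩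
    simp [act]
  have hfin : ∀ f, ∃ T : Finset O, ∀ φ, act φ f ∈ Submodule.span ℂ (T : Set O) := by
    intro f
    suffices ∀ z : O ⊗[ℂ] O, ∃ T : Finset O, ∀ φ : O →ₗ[ℂ] ℂ,
      TensorProduct.rid ℂ O (φ.lTensor O z) ∈ Submodule.span ℂ (T : Set O) from this _
    intro z
    induction z with
    | zero => exact ⟨∅, by simp⟩
    | tmul x y =>
      refine ⟨{x}, fun φ => ?_⟩
      simp only [LinearMap.lTensor_tmul, TensorProduct.rid_tmul]
      exact Submodule.smul_mem _ _ (Submodule.subset_span (by simp))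
    | add x y hx hy =>
      obtain ⟨T, hT⟩ := hx
      obtain ⟨T', hT'⟩ := hy
      refine ⟨T ∪ T', fun φ => ?_⟩
      simp only [map_add]
      exact add_mem (Submodule.span_mono (by simp) (hT φ)) (Submodule.span_mono (by simp) (hT' φ))
  choose T hT using hfin
  have hWle : W ≤ Submodule.span ℂ ((s.biUnion T : Finset O) : Set O) := by
    refine Submodule.span_le.2 ?_
    rintro _ ⟨f, hf, φ, rfl⟩
    refine Submodule.span_mono ?_ (hT f φ)
    exact_mod_cast Finset.subset_biUnion_of_mem T hf
  have : FiniteDimensional ℂ W := Submodule.finiteDimensional_of_le hWle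
  let v := Module.finBasis ℂ W
  let b := Module.Basis.ofVectorSpace ℂ O
  refine ⟨_, fun i => (v i : O), fun k i =>
    Finsupp.sum (TensorProduct.equivFinsuppOfBasisRight b (comul (R := ℂ) (v i : O)))
      fun l w => (if hw : w ∈ W then v.repr ⟨w, hw⟩ k else 0) • b l, ?_, ?_, ?_⟩
  · exact v.linearIndependent.map' W.subtype (by simp)
  · intro i
    conv_lhs => rw [← (TensorProduct.equivFinsuppOfBasisRight b).symm_apply_apply (comul (R := ℂ) (v i : O))]
    rw [TensorProduct.equivFinsuppOfBasisRight_symm_apply]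
    simp only [Finsupp.sum, TensorProduct.tmul_sum]
    rw [Finset.sum_comm]
    refine Finset.sum_congr rfl fun l _ => ?_
    have hw : TensorProduct.equivFinsuppOfBasisRight b (comul (R := ℂ) (v i : O)) l ∈ W := by
      rw [TensorProduct.equivFinsuppOfBasisRight_apply]
      exact hWact _ (v i).2 (b.coord l)
    simp only [dif_pos hw, TensorProduct.tmul_smul]
    simp only [TensorProduct.smul_tmul']
    rw [← TensorProduct.sum_tmul]
    congr 1
    have := congrArg Subtype.val (v.sum_repr ⟨_, hw⟩)
    simpa only [Submodule.coe_sum, Submodule.coe_smul] using this.symm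
  · intro f hf
    have := v.span_eq
    have h2 : Submodule.span ℂ (Set.range fun i => (v i : O)) = W := by
      have h3 := congrArg (Submodule.map W.subtype) this
      rw [Submodule.map_span, ← Set.range_comp] at h3
      simpa [Function.comp_def] using h3
    rw [h2]; exact hsW f hf

/-- The antipode inverts the coefficient matrix. -/
lemma coideal_inverse {O : Type*} [CommRing O] [HopfAlgebra ℂ O] {m : ℕ} (v : Fin m → O)
    (t : Fin m → Fin m → O) (hv : LinearIndependent ℂ v)
    (ht : ∀ i, comul (R := ℂ) (v i) = ∑ k, v k ⊗ₜ[ℂ] t k i) (i k : Fin m) :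
    ∑ j, HopfAlgebra.antipode ℂ (t i j) * t j k = if i = k then 1 else 0 := by
  classical
  obtain ⟨φ, hφ⟩ : ∃ φ : O →ₗ[ℂ] ℂ, ∀ j, φ (v j) = if i = j then 1 else 0 := by
    refine ⟨(Module.Basis.extend hv.linearIndepOn_id).constr ℂ
      (fun x => if v i = x then (1:ℂ) else 0), fun j => ?_⟩
    have : v j = (Module.Basis.extend hv.linearIndepOn_id)
      ⟨v j, Module.Basis.subset_extend _ ⟨j, rfl⟩⟩ := by simp
    conv_lhs => rw [this]
    rw [Module.Basis.constr_basis]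
    simp [hv.injective.eq_iff]
  have hε : counit (R := ℂ) (t i k) = if i = k then 1 else 0 := by
    have := Coalgebra.lTensor_counit_comul (R := ℂ) (v k)
    rw [ht, map_sum] at this
    have := congrArg (φ ∘ TensorProduct.rid ℂ O) this
    simpa [hφ] using this
  have hΔ : comul (R := ℂ) (t i k) = ∑ j, t i j ⊗ₜ[ℂ] t j k := by
    have := Coalgebra.coassoc_apply (R := ℂ) (v k)
    rw [ht] at this
    simp only [map_sum, LinearMap.rTensor_tmul, LinearMap.lTensor_tmul, ht,
      TensorProduct.sum_tmul, TensorProduct.assoc_tmul] at this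
    have := congrArg (TensorProduct.lid ℂ (O ⊗[ℂ] O) ∘ φ.rTensor (O ⊗[ℂ] O)) this
    simpa [hφ] using this.symm
  have := HopfAlgebra.mul_antipode_rTensor_comul_apply (R := ℂ) (t i k)
  rw [hΔ, hε] at this
  simp only [map_sum, LinearMap.rTensor_tmul, LinearMap.mul'_apply] at this
  rw [this]; split_ifs <;> simp

/-- Relations with coefficients in `A` between the `v k`. -/
def relSet {O : Type*} [CommRing O] [Algebra ℂ O] (A : Subalgebra ℂ O) {m : ℕ} (v : Fin m → O) :
    Set (Fin m → O) := {r | (∀ k, r k ∈ A) ∧ ∑ k, r k * v k = 0}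

/-- The `p`-minors of the relations. -/
def minorSet {O : Type*} [CommRing O] [Algebra ℂ O] (A : Subalgebra ℂ O) {m : ℕ} (v : Fin m → O)
    (p : ℕ) : Set O :=
  {d | ∃ (r : Fin p → Fin m → O) (e : Fin p → Fin m), (∀ a, r a ∈ relSet A v) ∧
    d = (Matrix.of fun a b => r a (e b)).det}

/-- Relations over `A ⊗ O` come from relations over `A`. -/
lemma rel_mem_span {O : Type*} [CommRing O] [HopfAlgebra ℂ O] (A : Subalgebra ℂ O) {m : ℕ}
    (v : Fin m → O) (ρ : Fin m → O ⊗[ℂ] O)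
    (hρ : ∀ k, ρ k ∈ (Algebra.TensorProduct.map A.val (AlgHom.id ℂ O)).range)
    (h0 : ∑ k, ρ k * (v k ⊗ₜ[ℂ] 1) = 0) :
    ρ ∈ Submodule.span (O ⊗[ℂ] O)
      ((fun (r : Fin m → O) (k : Fin m) => r k ⊗ₜ[ℂ] (1 : O)) '' relSet A v) := by
  classical
  let b := Module.Basis.ofVectorSpace ℂ O
  let B : Module.Basis _ O (O ⊗[ℂ] O) := b.baseChange O
  have hB : ∀ k l, B.repr (ρ k) l ∈ A := by
    intro k l
    obtain ⟨z, hz⟩ := hρ k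
    rw [← hz]
    clear hz
    induction z with
    | zero => simp
    | add x y hx hy => simp only [map_add, Finsupp.add_apply]; exact add_mem hx hy
    | tmul x y =>
      simp [B]
      exact A.smul_mem x.2 _
  let L := Finset.univ.biUnion fun k => (B.repr (ρ k)).support
  have hsum : ∀ k, ρ k = ∑ l ∈ L, B.repr (ρ k) l • B l := by
    intro k
    conv_lhs => rw [← B.linearCombination_repr (ρ k)]
    rw [Finsupp.linearCombination_apply, Finsupp.sum]
    refine Finset.sum_subset (Finset.subset_biUnion_of_mem (fun k => (B.repr (ρ k)).support)
      (Finset.mem_univ k)) ?_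
    intro l _ hl
    rw [Finsupp.notMem_support_iff.1 hl, zero_smul]
  have hρ' : ρ = ∑ l ∈ L, (B l) • (fun k => B.repr (ρ k) l ⊗ₜ[ℂ] (1 : O)) := by
    funext k
    rw [Finset.sum_apply]
    conv_lhs => rw [hsum k]
    refine Finset.sum_congr rfl fun l _ => ?_
    simp [B, TensorProduct.smul_tmul']
  rw [hρ']
  refine Submodule.sum_mem _ fun l _ => Submodule.smul_mem _ _ (Submodule.subset_span ?_)
  refine ⟨fun k => B.repr (ρ k) l, ⟨fun k => hB k l, ?_⟩, rfl⟩
  have h1 : ∀ k, ρ k * (v k ⊗ₜ[ℂ] (1 : O)) = v k • ρ k := by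
    intro k
    rw [Algebra.smul_def, mul_comm]; rfl
  simp_rw [h1] at h0
  have := congrArg (fun z => B.repr z l) h0
  simpa [Finsupp.finsetSum_apply, mul_comm] using this

lemma comul_minor_mem {O : Type*} [CommRing O] [HopfAlgebra ℂ O] (A : Subalgebra ℂ O)
    (hA : ∀ a ∈ A, comul (R := ℂ) a ∈ (Algebra.TensorProduct.map A.val (AlgHom.id ℂ O)).range)
    {m : ℕ} (v : Fin m → O) (t : Fin m → Fin m → O) (hv : LinearIndependent ℂ v)
    (ht : ∀ i, comul (R := ℂ) (v i) = ∑ k, v k ⊗ₜ[ℂ] t k i) (p : ℕ) (d : O)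
    (hd : d ∈ minorSet A v p) :
    comul (R := ℂ) d ∈ Ideal.span ((fun x : O => x ⊗ₜ[ℂ] (1 : O)) '' minorSet A v p) := by
  classical
  obtain ⟨r, e, hr, rfl⟩ := hd
  let Δ := Bialgebra.comulAlgHom ℂ O
  have hΔ : ∀ x, Δ x = comul (R := ℂ) x := fun _ => rfl
  let ρ : Fin p → Fin m → O ⊗[ℂ] O := fun a k => ∑ i, (1 ⊗ₜ[ℂ] t k i) * Δ (r a i)
  have hρ : ∀ a, ρ a ∈ Submodule.span (O ⊗[ℂ] O)
      ((fun (r : Fin m → O) (k : Fin m) => r k ⊗ₜ[ℂ] (1 : O)) '' relSet A v) := by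
    intro a
    apply rel_mem_span
    · intro k
      refine sum_mem fun i _ => mul_mem ⟨1 ⊗ₜ t k i, by simp⟩ (hA _ ((hr a).1 i))
    · have := congrArg Δ (hr a).2
      simp only [map_sum, map_mul, map_zero] at this
      simp only [hΔ (v _), ht, Finset.mul_sum] at this
      rw [Finset.sum_comm] at this
      rw [← this]
      refine Finset.sum_congr rfl fun k _ => ?_
      rw [Finset.sum_mul]
      refine Finset.sum_congr rfl fun i _ => ?_
      have : v k ⊗ₜ[ℂ] t k i = (1 ⊗ₜ[ℂ] t k i) * (v k ⊗ₜ[ℂ] 1) := by simp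
      rw [this]; ring
  have hr2 : ∀ a j, Δ (r a j) = ∑ k, (1 ⊗ₜ[ℂ] HopfAlgebra.antipode ℂ (t j k)) * ρ a k := by
    intro a j
    simp only [ρ, Finset.mul_sum]
    rw [Finset.sum_comm]
    have : ∀ i, ∑ k, ((1 : O) ⊗ₜ[ℂ] HopfAlgebra.antipode ℂ (t j k)) * ((1 ⊗ₜ[ℂ] t k i) * Δ (r a i))
        = if j = i then Δ (r a i) else 0 := by
      intro i
      simp_rw [← mul_assoc, ← Finset.sum_mul, Algebra.TensorProduct.tmul_mul_tmul, one_mul,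
        ← TensorProduct.tmul_sum, coideal_inverse v t hv ht]
      split_ifs
      · rw [← Algebra.TensorProduct.one_def, one_mul]
      · simp
    simp_rw [this]
    simp
  have key := minor_mem_of_span (p := p)
    (Ideal.span ((fun x : O => x ⊗ₜ[ℂ] (1 : O)) '' minorSet A v p))
    ((fun (r : Fin m → O) (k : Fin m) => r k ⊗ₜ[ℂ] (1 : O)) '' relSet A v) ?_
    (fun b k => 1 ⊗ₜ[ℂ] HopfAlgebra.antipode ℂ (t (e b) k)) ρ hρ
  · convert key using 1
    rw [← hΔ, AlgHom.map_det]
    congr 1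
    ext1 a b
    simp only [AlgHom.mapMatrix_apply, Matrix.map_apply, Matrix.of_apply]
    exact hr2 _ _
  · intro x hx e'
    choose q hq hqx using hx
    refine Ideal.subset_span ⟨(Matrix.of fun a b => q a (e' b)).det, ⟨q, e', hq, rfl⟩, ?_⟩
    change (Algebra.TensorProduct.includeLeft : O →ₐ[ℂ] O ⊗[ℂ] O) _ = _
    rw [AlgHom.map_det]
    congr 1
    ext1 a b
    simp [← hqx]

lemma minor_span_eq_top {O : Type*} [CommRing O] [HopfAlgebra ℂ O] (A : Subalgebra ℂ O)
    (hA : ∀ a ∈ A, comul (R := ℂ) a ∈ (Algebra.TensorProduct.map A.val (AlgHom.id ℂ O)).range)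
    {m : ℕ} (v : Fin m → O) (t : Fin m → Fin m → O) (hv : LinearIndependent ℂ v)
    (ht : ∀ i, comul (R := ℂ) (v i) = ∑ k, v k ⊗ₜ[ℂ] t k i) (p : ℕ) (f : O)
    (hf : f ∈ minorSet A v p) (hf0 : f ≠ 0) : Ideal.span (minorSet A v p) = ⊤ := by
  have hmap : ∀ (g : O ⊗[ℂ] O →ₐ[ℂ] O) (J : Ideal O), (∀ d ∈ minorSet A v p, g (d ⊗ₜ 1) ∈ J) →
      ∀ d ∈ minorSet A v p, g (comul (R := ℂ) d) ∈ J := by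
    intro g J h d hd
    have h1 := comul_minor_mem A hA v t hv ht p d hd
    have h2 : Ideal.span ((fun x : O => x ⊗ₜ[ℂ] (1 : O)) '' minorSet A v p) ≤ J.comap g := by
      rw [Ideal.span_le]
      rintro _ ⟨d, hd, rfl⟩
      exact h d hd
    exact h2 h1
  obtain ⟨d, hd, hd0⟩ : ∃ d ∈ minorSet A v p, counit (R := ℂ) d ≠ 0 := by
    by_contra! hcon
    apply hf0
    have := hmap (Algebra.TensorProduct.lift ((Algebra.ofId ℂ O).comp (Bialgebra.counitAlgHom ℂ O))
      (AlgHom.id ℂ O) (fun _ _ => Commute.all _ _)) ⊥ (by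
        intro d hd; simp [hcon d hd]) f hf
    rw [Ideal.mem_bot] at this
    rw [← this]
    have h3 := congrArg (TensorProduct.lid ℂ O) (Coalgebra.rTensor_counit_comul (R := ℂ) f)
    rw [TensorProduct.lid_tmul, one_smul] at h3
    refine h3.symm.trans ?_
    clear this h3
    induction (comul (R := ℂ) f) with
    | zero => simp
    | add x y hx hy => simp only [map_add, hx, hy]
    | tmul x y => simp [Algebra.ofId_apply, Algebra.smul_def]
  have := hmap (Algebra.TensorProduct.lift (AlgHom.id ℂ O) (HopfAlgebra.antipodeAlgHom ℂ O)
    (fun _ _ => Commute.all _ _)) (Ideal.span (minorSet A v p)) (by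
      intro d hd; simpa using Ideal.subset_span hd) d hd
  have h4 : (Algebra.TensorProduct.lift (AlgHom.id ℂ O) (HopfAlgebra.antipodeAlgHom ℂ O)
    (fun _ _ => Commute.all _ _)) (comul (R := ℂ) d) = algebraMap ℂ O (counit (R := ℂ) d) := by
    rw [← HopfAlgebra.mul_antipode_lTensor_comul_apply]
    induction (comul (R := ℂ) d) with
    | zero => simp
    | add x y hx hy => simp only [map_add, hx, hy]
    | tmul x y => simp
  rw [h4] at this
  exact Ideal.eq_top_of_isUnit_mem _ this ((IsUnit.mk0 _ hd0).map (algebraMap ℂ O))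

/-- Relations over `O` are `O`-combinations of relations over `A`. -/
lemma rel_flat {O : Type*} [CommRing O] [HopfAlgebra ℂ O] (A : Subalgebra ℂ O)
    (hA : ∀ a ∈ A, comul (R := ℂ) a ∈ (Algebra.TensorProduct.map A.val (AlgHom.id ℂ O)).range)
    {n : ℕ} (f : Fin n → O) (hf : ∀ i, f i ∈ A) (g : Fin n → O) (hg : ∑ i, g i * f i = 0) :
    g ∈ Submodule.span O (relSet A f) := by
  classical
  obtain ⟨m, v, t, hv, ht, hs⟩ := exists_coideal (Finset.univ.image g)
  have h01 : (1 : O) ≠ 0 := by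
    intro h
    have := congrArg (Bialgebra.counitAlgHom ℂ O) h
    simp at this
  obtain ⟨p, ⟨d₀, hd₀, hne⟩, hp⟩ : ∃ p, (∃ d ∈ minorSet A v p, d ≠ 0) ∧
      ∀ d ∈ minorSet A v (p + 1), d = 0 := by
    by_contra! hcon
    have hall : ∀ p, ∃ d ∈ minorSet A v p, d ≠ 0 := by
      intro p
      induction p with
      | zero => exact ⟨1, ⟨Fin.elim0, Fin.elim0, fun a => a.elim0, by simp⟩, h01⟩
      | succ p ih => 
        exact hcon p ih
    obtain ⟨d, ⟨r, e, hr, rfl⟩, hd0⟩ := hall (m + 1)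
    obtain ⟨i, j, hij, he⟩ := Fintype.exists_ne_map_eq_of_card_lt e (by simp)
    exact hd0 (Matrix.det_zero_of_column_eq hij (by simp [he]))
  have htop := minor_span_eq_top A hA v t hv ht p d₀ hd₀ hne
  have hx : ∀ i, ∃ c : Fin m → ℂ, ∑ k, c k • v k = g i := fun i =>
    (Submodule.mem_span_range_iff_exists_fun ℂ).1 (hs (g i) (by simp))
  choose c hc using hx
  let x : Fin n → Fin m → O := fun i k => algebraMap ℂ O (c i k)
  have hxg : ∀ i, ∑ k, x i k * v k = g i := by
    intro i; rw [← hc]; simp [x, Algebra.smul_def]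
  have hle : Ideal.span (minorSet A v p) ≤
      (Submodule.span O (relSet A f)).comap (LinearMap.toSpanSingleton O (Fin n → O) g) := by
    rw [Ideal.span, Submodule.span_le]
    rintro d ⟨r, e, hr, rfl⟩
    change (Matrix.of fun a b => r a (e b)).det • g ∈ Submodule.span O (relSet A f)
    have h1 : (Matrix.of fun a b => r a (e b)).det • g =
        ∑ j, v j • (fun i => bordered r e (x i) j) := by
      funext i
      obtain ⟨γ, hγ⟩ := bordered_expand r e (x i)
      simp only [Pi.smul_apply, Finset.sum_apply, smul_eq_mul, hγ]
      simp_rw [mul_add, Finset.sum_add_distrib, Finset.mul_sum]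
      rw [Finset.sum_comm]
      have : ∀ a, ∑ j, v j * (γ a * r a j) = 0 := by
        intro a
        have := (hr a).2
        calc _ = γ a * ∑ j, r a j * v j := by
              rw [Finset.mul_sum]; exact Finset.sum_congr rfl fun _ _ => by ring
          _ = 0 := by rw [this, mul_zero]
      simp_rw [this]
      rw [← hxg i, Finset.mul_sum]
      simp only [Finset.sum_const_zero, add_zero]
      exact Finset.sum_congr rfl fun _ _ => by ring
    rw [h1]
    refine Submodule.sum_mem _ fun j _ => Submodule.smul_mem _ _ (Submodule.subset_span ⟨?_, ?_⟩)
    · intro i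
      exact bordered_mem A r e _ j (fun a k => (hr a).1 k) (fun k => A.algebraMap_mem _)
    · simp_rw [mul_comm _ (f _)]
      rw [← bordered_sum]
      apply hp
      refine ⟨_, _, ?_, rfl⟩
      intro a
      refine Fin.cases ?_ (fun a => ?_) a
      · rw [Fin.cons_zero]
        refine ⟨fun k => sum_mem fun i _ => mul_mem (hf i) (A.algebraMap_mem _), ?_⟩
        simp_rw [Finset.sum_mul]
        rw [Finset.sum_comm, ← hg]
        refine Finset.sum_congr rfl fun i _ => ?_
        rw [← hxg i, Finset.sum_mul]
        exact Finset.sum_congr rfl fun _ _ => by ring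
      · rw [Fin.cons_succ]; exact hr a
  rw [htop] at hle
  have := hle (Submodule.mem_top (x := (1 : O)))
  simpa using this

/-- The algebra of global functions on an affine group scheme over ℂ, i.e. a
commutative Hopf algebra over ℂ, is a coherent ring: every finitely generated
ideal is finitely presented as a module. -/
theorem commHopfAlgebra_coherent
    (O : Type*) [CommRing O] [HopfAlgebra ℂ O]
    (I : Ideal O) (hI : I.FG) :
    Module.FinitePresentation O I := by
  classical
  obtain ⟨n, f, hfI⟩ := Submodule.fg_iff_exists_fin_generating_family.1 hI
  obtain ⟨m, w, t, -, ht, hs⟩ := exists_coideal (Finset.univ.image f)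
  let A : Subalgebra ℂ O := Algebra.adjoin ℂ (Set.range w)
  have hwA : ∀ k, w k ∈ A := fun k => Algebra.subset_adjoin ⟨k, rfl⟩
  have hA : ∀ a ∈ A, comul (R := ℂ) a ∈
      (Algebra.TensorProduct.map A.val (AlgHom.id ℂ O)).range := by
    have : A ≤ ((Algebra.TensorProduct.map A.val (AlgHom.id ℂ O)).range).comap
        (Bialgebra.comulAlgHom ℂ O) := by
      refine Algebra.adjoin_le ?_
      rintro _ ⟨i, rfl⟩
      change comul (R := ℂ) (w i) ∈ (Algebra.TensorProduct.map A.val (AlgHom.id ℂ O)).range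
      rw [ht]
      exact sum_mem fun k _ => ⟨(⟨w k, hwA k⟩ : A) ⊗ₜ t k i, by simp⟩
    exact fun a ha => this ha
  have hf : ∀ i, f i ∈ A := by
    intro i
    have h1 : Submodule.span ℂ (Set.range w) ≤ Subalgebra.toSubmodule A :=
      Submodule.span_le.2 (by rintro _ ⟨k, rfl⟩; exact hwA k)
    exact h1 (hs (f i) (by simp))
  have hft : Algebra.FiniteType ℂ A :=
    (Subalgebra.fg_iff_finiteType A).1 (Subalgebra.fg_def.2 ⟨_, Set.finite_range w, rfl⟩)
  have hN : IsNoetherianRing A := Algebra.FiniteType.isNoetherianRing ℂ A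
  -- relations over `A`
  let K : Submodule A (Fin n → A) :=
    LinearMap.ker (Fintype.linearCombination A (fun i => (⟨f i, hf i⟩ : A)))
  obtain ⟨S, hS⟩ : K.FG := IsNoetherian.noetherian K
  let c : (Fin n → A) →ₗ[A] (Fin n → O) := (Algebra.linearMap A O).compLeft (Fin n)
  have hc : ∀ x i, c x i = (x i : O) := fun _ _ => rfl
  have hfi : ∀ i, f i ∈ I := fun i => hfI ▸ Submodule.subset_span ⟨i, rfl⟩
  let l : (Fin n → O) →ₗ[O] I := Fintype.linearCombination O (fun i => (⟨f i, hfi i⟩ : I))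
  have hl : ∀ g, ((l g : I) : O) = ∑ i, g i * f i := by
    intro g; simp [l, Fintype.linearCombination_apply]
  refine Module.finitePresentation_of_surjective l ?_ ?_
  · rintro ⟨y, hy⟩
    rw [← hfI] at hy
    obtain ⟨g, hg⟩ := (Submodule.mem_span_range_iff_exists_fun O).1 hy
    exact ⟨g, Subtype.ext (by rw [hl]; simpa using hg)⟩
  · refine ⟨S.image c, ?_⟩
    apply le_antisymm
    · rw [Submodule.span_le]
      intro z hz
      rw [Finset.coe_image] at hz
      obtain ⟨x, hx, rfl⟩ := hz
      have hxK : x ∈ K := hS ▸ Submodule.subset_span hx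
      have h2 : ∑ i, x i * (⟨f i, hf i⟩ : A) = 0 := by
        simpa [K, Fintype.linearCombination_apply] using hxK
      have h3 := congrArg A.val h2
      rw [map_sum, map_zero] at h3
      refine LinearMap.mem_ker.2 (Subtype.ext ?_)
      rw [hl]
      exact h3
    · intro g hg
      have hg0 : ∑ i, g i * f i = 0 := by
        rw [← hl, LinearMap.mem_ker.1 hg]; rfl
      refine (Submodule.span_le.2 ?_ : Submodule.span O (relSet A f) ≤ _)
        (rel_flat A hA f hf g hg0)
      rintro r ⟨hrA, hr⟩
      let r' : Fin n → A := fun i => ⟨r i, hrA i⟩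
      have hr' : r' ∈ K := by
        refine LinearMap.mem_ker.2 ?_
        rw [Fintype.linearCombination_apply]
        apply Subtype.val_injective
        change A.val _ = 0
        rw [map_sum]
        exact hr
      have h4 : c r' ∈ Submodule.map c K := ⟨r', hr', rfl⟩
      rw [← hS, Submodule.map_span, ← Finset.coe_image] at h4
      exact Submodule.span_le_restrictScalars A O _ h4
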